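/- Let $K \ge 1$, let $a_1,\dots,a_K \in \mathbb{R}$, and let $P_{\max} > 0$ satisfy $\sum_{k=1}^K \max(a_k,0) \ge P_{\max}$. Suppose $\zeta \ge 0$ satisfies $\sum_{k=1}^K \max(a_k - \zeta/2,\,0) = P_{\max}$. Then the point $x^\dagger$ with coordinates $x^\dagger_k = \max(a_k - \zeta/2,\,0)$ is the unique minimizer of $\sum_{k=1}^K (x_k - a_k)^2$ over the set $\mathcal{S}_1 = \{x \in \mathbb{R}^K : x_k \ge 0 \text{ for all } k,\ \sum_{k=1}^K x_k \le P_{\max}\}$. -/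

import Mathlib

/-- Strong-convexity bound for `y ↦ (y - a) ^ 2 + 2 * c * y` on `y ≥ 0` at its minimizer
`max (a - c) 0`. -/
theorem sq_max_sub_add_le (a c y : ℝ) (hy : 0 ≤ y) :
    (max (a - c) 0 - a) ^ 2 + (y - max (a - c) 0) ^ 2 + 2 * c * (max (a - c) 0 - y)
      ≤ (y - a) ^ 2 := by
  rcases le_total 0 (a - c) with h | h
  · rw [max_eq_left h]
    exact le_of_eq (by ring)
  · rw [max_eq_right h]
    nlinarith [mul_nonneg hy (sub_nonneg.2 h)]

/-- Theorem 1 of the paper (active-budget case): with water level `ζ ≥ 0` satisfying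
`∑ k, max (a k - ζ/2) 0 = Pmax`, the point `x† k = max (a k - ζ/2) 0` is the unique
minimizer of `∑ k, (x k - a k)^2` over
`S₁ = {x | ∀ k, 0 ≤ x k ∧ ∑ k, x k ≤ Pmax}`. -/
theorem projection_active_budget (K : ℕ) (hK : 1 ≤ K) (a : Fin K → ℝ)
    (Pmax : ℝ) (hP : 0 < Pmax) (hsum : Pmax ≤ ∑ k, max (a k) 0)
    (ζ : ℝ) (hζ : 0 ≤ ζ) (hroot : ∑ k, max (a k - ζ / 2) 0 = Pmax) :
    ((∀ k, 0 ≤ max (a k - ζ / 2) 0) ∧ ∑ k, max (a k - ζ / 2) 0 ≤ Pmax) ∧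
    ∀ x : Fin K → ℝ, (∀ k, 0 ≤ x k) → (∑ k, x k ≤ Pmax) →
      x ≠ (fun k => max (a k - ζ / 2) 0) →
      ∑ k, (max (a k - ζ / 2) 0 - a k) ^ 2 < ∑ k, (x k - a k) ^ 2 := by
  refine ⟨⟨fun k => le_max_right _ _, hroot.le⟩, fun x hx hxP hne => ?_⟩
  obtain ⟨j, hj⟩ := Function.ne_iff.1 hne
  have hdist : 0 < ∑ k, (x k - max (a k - ζ / 2) 0) ^ 2 :=
    Finset.sum_pos' (fun k _ => sq_nonneg _)
      ⟨j, Finset.mem_univ j, sq_pos_of_ne_zero (sub_ne_zero.2 hj)⟩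
  have hbound := Finset.sum_le_sum fun k (_ : k ∈ Finset.univ) =>
    sq_max_sub_add_le (a k) (ζ / 2) (x k) (hx k)
  rw [Finset.sum_add_distrib, Finset.sum_add_distrib, ← Finset.mul_sum,
    Finset.sum_sub_distrib, hroot] at hbound
  have hslack : 0 ≤ 2 * (ζ / 2) * (Pmax - ∑ k, x k) :=
    mul_nonneg (by linarith) (sub_nonneg.2 hxP)
  linarith
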